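/- Let E be a finite-dimensional real inner product space, W ∈ E with ‖W‖ < 1, λ := 1 − ⟪W,W⟫, F(V) = (√(⟪W,V⟫² + λ⟪V,V⟫) − ⟪W,V⟫)/λ the Randers metric, A ⊆ E a nonempty compact set, and ρ(q) := inf_{p∈A} F(q − p). Suppose p ∈ A, q ∈ E and τ > 0 satisfy ρ(q) = F(q − p) = τ (so the straight segment from p to q is a minimizing wave ray reaching q at time τ). Then for every s ∈ [0,1], ρ(p + s•(q − p)) = s·τ; that is, the wave ray γ(t) = p + (t/τ)•(q − p) lies on the wavefront at time t for every t ∈ [0,τ]. -/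

import Mathlib

open scoped RealInnerProductSpace

section RandersMetric

variable {E : Type*} [NormedAddCommGroup E] [InnerProductSpace ℝ E]

/-- The Randers metric of a constant wind `W`. -/
noncomputable def randersMetric (W V : E) : ℝ :=
  (Real.sqrt (⟪W, V⟫ ^ 2 + (1 - ⟪W, W⟫) * ⟪V, V⟫) - ⟪W, V⟫) / (1 - ⟪W, W⟫)

lemma one_sub_inner_self_pos {W : E} (hW : ‖W‖ < 1) : 0 < 1 - ⟪W, W⟫ := by
  rw [real_inner_self_eq_norm_sq]
  nlinarith [norm_nonneg W]

lemma sqrt_randers_eq_norm {W : E} (hW : ‖W‖ < 1) (V : E) :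
    Real.sqrt (⟪W, V⟫ ^ 2 + (1 - ⟪W, W⟫) * ⟪V, V⟫) =
      ‖WithLp.toLp 2 (⟪W, V⟫, Real.sqrt (1 - ⟪W, W⟫) • V)‖ := by
  rw [WithLp.prod_norm_eq_of_L2, WithLp.toLp_fst, WithLp.toLp_snd, norm_smul, mul_pow,
    Real.norm_eq_abs, Real.norm_eq_abs, sq_abs, sq_abs, Real.sq_sqrt (one_sub_inner_self_pos hW).le,
    real_inner_self_eq_norm_sq V]

lemma randersMetric_nonneg {W : E} (hW : ‖W‖ < 1) (V : E) : 0 ≤ randersMetric W V := by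
  have hl := one_sub_inner_self_pos hW
  refine div_nonneg (sub_nonneg.2 (Real.le_sqrt_of_sq_le ?_)) hl.le
  exact le_add_of_nonneg_right (mul_nonneg hl.le real_inner_self_nonneg)

lemma randersMetric_smul (W V : E) {c : ℝ} (hc : 0 ≤ c) :
    randersMetric W (c • V) = c * randersMetric W V := by
  have h : ⟪W, c • V⟫ ^ 2 + (1 - ⟪W, W⟫) * ⟪c • V, c • V⟫ =
      c ^ 2 * (⟪W, V⟫ ^ 2 + (1 - ⟪W, W⟫) * ⟪V, V⟫) := by
    simp only [real_inner_smul_left, real_inner_smul_right]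
    ring
  rw [randersMetric, randersMetric, h, Real.sqrt_mul (sq_nonneg c), Real.sqrt_sq hc,
    real_inner_smul_right]
  ring

lemma randersMetric_add_le {W : E} (hW : ‖W‖ < 1) (U V : E) :
    randersMetric W (U + V) ≤ randersMetric W U + randersMetric W V := by
  have h := norm_add_le (WithLp.toLp 2 (⟪W, U⟫, Real.sqrt (1 - ⟪W, W⟫) • U))
    (WithLp.toLp 2 (⟪W, V⟫, Real.sqrt (1 - ⟪W, W⟫) • V))
  rw [← WithLp.toLp_add, Prod.mk_add_mk, ← inner_add_right, ← smul_add,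
    ← sqrt_randers_eq_norm hW, ← sqrt_randers_eq_norm hW, ← sqrt_randers_eq_norm hW] at h
  rw [randersMetric, randersMetric, randersMetric, ← add_div]
  refine div_le_div_of_nonneg_right ?_ (one_sub_inner_self_pos hW).le
  linarith [inner_add_right (𝕜 := ℝ) W U V]

end RandersMetric

theorem wave_ray_crosses_intermediate_wavefronts
    {E : Type*} [NormedAddCommGroup E] [InnerProductSpace ℝ E]
    [FiniteDimensional ℝ E]
    (W : E) (hW : ‖W‖ < 1)
    (F : E → ℝ)
    (hF : ∀ V : E, F V =
      (Real.sqrt (⟪W, V⟫ ^ 2 + (1 - ⟪W, W⟫) * ⟪V, V⟫) - ⟪W, V⟫) / (1 - ⟪W, W⟫))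
    (A : Set E) (hA : A.Nonempty) (hAc : IsCompact A)
    (ρ : E → ℝ)
    (hρ : ∀ q : E, ρ q = sInf ((fun p => F (q - p)) '' A))
    (p q : E) (τ : ℝ) (hτ : 0 < τ)
    (hpA : p ∈ A) (hmin : ρ q = F (q - p)) (hdist : F (q - p) = τ) :
    ∀ s ∈ Set.Icc (0 : ℝ) 1, ρ (p + s • (q - p)) = s * τ := by
  obtain rfl : F = randersMetric W := funext hF
  rintro s ⟨hs0, hs1⟩
  have hbdd (x : E) : BddBelow ((fun a => randersMetric W (x - a)) '' A) :=
    ⟨0, by rintro _ ⟨a, -, rfl⟩; exact randersMetric_nonneg hW _⟩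
  have hray : randersMetric W (p + s • (q - p) - p) = s * τ := by
    rw [add_sub_cancel_left, randersMetric_smul W _ hs0, hdist]
  rw [hρ]
  refine le_antisymm (hray ▸ csInf_le (hbdd _) ⟨p, hpA, rfl⟩) (le_csInf (hA.image _) ?_)
  rintro _ ⟨a, ha, rfl⟩
  have hle : τ ≤ randersMetric W (q - a) := by
    rw [← hdist, ← hmin, hρ]
    exact csInf_le (hbdd _) ⟨a, ha, rfl⟩
  have htri := randersMetric_add_le hW (p + s • (q - p) - a) ((1 - s) • (q - p))
  rw [show p + s • (q - p) - a + (1 - s) • (q - p) = q - a by module,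
    randersMetric_smul W _ (sub_nonneg.2 hs1), hdist] at htri
  change s * τ ≤ randersMetric W (p + s • (q - p) - a)
  linarith
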